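/- arXiv:1610.03037 — 6 statements merged into one kernel-verified Lean document; each statement's English description precedes it below -/
import Mathlib

section
/- Let (G,·,1,d) be a separable abelian normed metric group, let n ∈ ℕ, x₁,…,xₙ ∈ G, and let E denote the uniform average over sign vectors ε ∈ {−1,1}ⁿ. Then for all p, q ∈ [1,∞), ( E[ d(1, ∏ₖ xₖ^{εₖ})^q ] )^{1/q} ≤ C_{p,q} · ( E[ d(1, ∏ₖ xₖ^{εₖ})^p ] )^{1/p}, where one may take C_{p,q} = 1 if q ≤ p and C_{p,q} = 64·q·(q/4)^{1/q} if q > p. -/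
/-- The uniform average of a function on the discrete cube. -/
noncomputable def cubeMean {n : ℕ} (f : (Fin n → Bool) → ℝ) : ℝ :=
  (∑ ε, f ε) / 2 ^ n

/-- The noise operator with correlation `1 / 2` on the discrete cube. -/
noncomputable def cubeNoise : (n : ℕ) → ((Fin n → Bool) → ℝ) → (Fin n → Bool) → ℝ
  | 0, f => f
  | n + 1, f => fun ε =>
      3 / 4 * cubeNoise n (fun δ => f (Fin.cons (ε 0) δ)) (Fin.tail ε)
        + 1 / 4 * cubeNoise n (fun δ => f (Fin.cons (!ε 0) δ)) (Fin.tail ε)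

lemma cubeMean_zero (f : (Fin 0 → Bool) → ℝ) : cubeMean f = f default := by
  rw [cubeMean, Fintype.sum_unique, pow_zero, div_one]
  exact congrArg f (Subsingleton.elim _ _)

lemma cubeMean_succ {n : ℕ} (f : (Fin (n + 1) → Bool) → ℝ) :
    cubeMean f =
      cubeMean fun δ : Fin n → Bool => (f (Fin.cons true δ) + f (Fin.cons false δ)) / 2 := by
  have h : ∑ ε, f ε = ∑ δ : Fin n → Bool, (f (Fin.cons true δ) + f (Fin.cons false δ)) := by
    rw [← (Fin.consEquiv fun _ : Fin (n + 1) => Bool).sum_comp f, Fintype.sum_prod_type,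
      Fintype.sum_bool, Finset.sum_add_distrib]
    rfl
  simp only [cubeMean, h, ← Finset.sum_div]
  rw [pow_succ, div_div, mul_comm]

lemma cubeMean_add {n : ℕ} (f g : (Fin n → Bool) → ℝ) :
    cubeMean (fun ε => f ε + g ε) = cubeMean f + cubeMean g := by
  simp [cubeMean, Finset.sum_add_distrib, add_div]

lemma cubeMean_const_mul {n : ℕ} (c : ℝ) (f : (Fin n → Bool) → ℝ) :
    cubeMean (fun ε => c * f ε) = c * cubeMean f := by
  simp [cubeMean, ← Finset.mul_sum, mul_div_assoc]

lemma cubeMean_mono {n : ℕ} {f g : (Fin n → Bool) → ℝ} (h : ∀ ε, f ε ≤ g ε) :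
    cubeMean f ≤ cubeMean g := by
  unfold cubeMean
  gcongr with ε
  exact h ε

lemma cubeMean_nonneg {n : ℕ} {f : (Fin n → Bool) → ℝ} (h : ∀ ε, 0 ≤ f ε) :
    0 ≤ cubeMean f :=
  div_nonneg (Finset.sum_nonneg fun ε _ => h ε) (by positivity)

lemma cubeMean_mul_sq_le {n : ℕ} (f g : (Fin n → Bool) → ℝ) :
    cubeMean (fun ε => f ε * g ε) ^ 2 ≤
      cubeMean (fun ε => f ε ^ 2) * cubeMean (fun ε => g ε ^ 2) := by
  unfold cubeMean
  rw [div_pow, div_mul_div_comm, ← sq]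
  gcongr
  exact Finset.sum_mul_sq_le_sq_mul_sq _ _ _

lemma cubeMean_rpow_le {n : ℕ} {f : (Fin n → Bool) → ℝ} (hf : ∀ ε, 0 ≤ f ε) {r : ℝ}
    (hr : 1 ≤ r) : cubeMean f ^ r ≤ cubeMean fun ε => f ε ^ r := by
  have h := Real.rpow_arith_mean_le_arith_mean_rpow Finset.univ
    (fun _ : Fin n → Bool => ((2 : ℝ) ^ n)⁻¹) f (fun _ _ => by positivity) (by simp)
    (fun ε _ => hf ε) hr
  simpa only [cubeMean, div_eq_inv_mul, Finset.mul_sum] using h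

lemma cubeMean_rpow_inv_mono {n : ℕ} {f : (Fin n → Bool) → ℝ} (hf : ∀ ε, 0 ≤ f ε) {p q : ℝ}
    (hp : 0 < p) (hpq : p ≤ q) :
    cubeMean (fun ε => f ε ^ p) ^ (1 / p) ≤ cubeMean (fun ε => f ε ^ q) ^ (1 / q) := by
  have hq : 0 < q := hp.trans_le hpq
  have hfp : ∀ ε, 0 ≤ f ε ^ p := fun ε => Real.rpow_nonneg (hf ε) p
  have h := cubeMean_rpow_le hfp ((one_le_div hp).2 hpq)
  simp only [← Real.rpow_mul (hf _), mul_div_cancel₀ _ hp.ne'] at h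
  calc cubeMean (fun ε => f ε ^ p) ^ (1 / p)
      = (cubeMean (fun ε => f ε ^ p) ^ (q / p)) ^ (1 / q) := by
        rw [← Real.rpow_mul (cubeMean_nonneg hfp)]
        congr 1
        field_simp
    _ ≤ _ := Real.rpow_le_rpow (Real.rpow_nonneg (cubeMean_nonneg hfp) _) h (by positivity)

lemma cubeNoise_linear {n : ℕ} (a b : ℝ) (f g : (Fin n → Bool) → ℝ) (ε : Fin n → Bool) :
    cubeNoise n (fun δ => a * f δ + b * g δ) ε = a * cubeNoise n f ε + b * cubeNoise n g ε := by
  induction n with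
  | zero => rfl
  | succ n ih =>
    simp only [cubeNoise, ih]
    ring

lemma cubeNoise_nonneg {n : ℕ} {f : (Fin n → Bool) → ℝ} (hf : ∀ ε, 0 ≤ f ε)
    (ε : Fin n → Bool) : 0 ≤ cubeNoise n f ε := by
  induction n with
  | zero => exact hf ε
  | succ n ih =>
    simp only [cubeNoise]
    exact add_nonneg (mul_nonneg (by norm_num) (ih (fun δ => hf _) _))
      (mul_nonneg (by norm_num) (ih (fun δ => hf _) _))

lemma cubeNoise_pow_le {n : ℕ} {f : (Fin n → Bool) → ℝ} (hf : ∀ ε, 0 ≤ f ε) (k : ℕ)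
    (ε : Fin n → Bool) : cubeNoise n f ε ^ k ≤ cubeNoise n (fun δ => f δ ^ k) ε := by
  induction n with
  | zero => rfl
  | succ n ih =>
    simp only [cubeNoise]
    have h := (convexOn_pow k).2
      (cubeNoise_nonneg (fun δ => hf (Fin.cons (ε 0) δ)) (Fin.tail ε))
      (cubeNoise_nonneg (fun δ => hf (Fin.cons (!ε 0) δ)) (Fin.tail ε))
      (show (0 : ℝ) ≤ 3 / 4 by norm_num) (show (0 : ℝ) ≤ 1 / 4 by norm_num) (by norm_num)
    simp only [smul_eq_mul] at h
    refine h.trans ?_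
    gcongr
    · exact ih (fun δ => hf _) _
    · exact ih (fun δ => hf _) _

/-- Hypercontractivity of the noise operator from `L²` to `L⁴`. -/
lemma cubeMean_cubeNoise_pow_four_le {n : ℕ} (f : (Fin n → Bool) → ℝ) :
    cubeMean (fun ε => cubeNoise n f ε ^ 4) ≤ cubeMean (fun ε => f ε ^ 2) ^ 2 := by
  induction n with
  | zero =>
    simp only [cubeMean_zero, cubeNoise]
    exact le_of_eq (by ring)
  | succ n ih =>
    set g : (Fin n → Bool) → ℝ :=
      fun δ => 1 / 2 * f (Fin.cons true δ) + 1 / 2 * f (Fin.cons false δ) with hg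
    set h : (Fin n → Bool) → ℝ :=
      fun δ => 1 / 2 * f (Fin.cons true δ) + -1 / 2 * f (Fin.cons false δ) with hh
    set u := cubeNoise n g with hu
    set v := cubeNoise n h with hv
    have hL : cubeMean (fun ε => cubeNoise (n + 1) f ε ^ 4) =
        cubeMean (fun δ => u δ ^ 4)
          + (3 / 2 * cubeMean (fun δ => u δ ^ 2 * v δ ^ 2)
            + 1 / 16 * cubeMean (fun δ => v δ ^ 4)) := by
      rw [cubeMean_succ, ← cubeMean_const_mul, ← cubeMean_const_mul, ← cubeMean_add,
        ← cubeMean_add]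
      congr 1
      funext δ
      simp only [cubeNoise, Fin.cons_zero, Fin.tail_cons, Bool.not_true, Bool.not_false, hu, hv,
        hg, hh, cubeNoise_linear]
      ring
    have hR : cubeMean (fun ε => f ε ^ 2) =
        cubeMean (fun δ => g δ ^ 2) + cubeMean (fun δ => h δ ^ 2) := by
      rw [cubeMean_succ, ← cubeMean_add]
      congr 1
      funext δ
      simp only [hg, hh]
      ring
    have hA : 0 ≤ cubeMean (fun δ => g δ ^ 2) := cubeMean_nonneg fun δ => sq_nonneg _
    have hB : 0 ≤ cubeMean (fun δ => h δ ^ 2) := cubeMean_nonneg fun δ => sq_nonneg _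
    have hcs := cubeMean_mul_sq_le (fun δ => u δ ^ 2) (fun δ => v δ ^ 2)
    simp only [← pow_mul] at hcs
    norm_num at hcs
    have hv4 : 0 ≤ cubeMean (fun δ => v δ ^ 4) := cubeMean_nonneg fun δ => by positivity
    have huv : cubeMean (fun δ => u δ ^ 2 * v δ ^ 2) ≤
        cubeMean (fun δ => g δ ^ 2) * cubeMean (fun δ => h δ ^ 2) := by
      refine le_of_sq_le_sq ?_ (mul_nonneg hA hB)
      rw [mul_pow]
      exact hcs.trans (mul_le_mul (ih g) (ih h) hv4 (sq_nonneg _))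
    rw [hL, hR]
    nlinarith [ih g, ih h, mul_nonneg hA hB]

section Moments

variable {n : ℕ} {f : (Fin n → Bool) → ℝ}

lemma cubeMean_pow_four_mul_le (hf : ∀ ε, 0 ≤ f ε) (hT : ∀ ε, f ε ≤ 2 * cubeNoise n f ε)
    (k : ℕ) :
    cubeMean (fun ε => f ε ^ (4 * k)) ≤ 16 ^ k * cubeMean (fun ε => f ε ^ (2 * k)) ^ 2 := by
  have h := cubeMean_cubeNoise_pow_four_le fun ε => f ε ^ k
  simp only [← pow_mul, mul_comm k] at h
  refine le_trans ?_ (mul_le_mul_of_nonneg_left h (by positivity))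
  rw [← cubeMean_const_mul]
  refine cubeMean_mono fun ε => ?_
  have h1 : f ε ^ k ≤ 2 ^ k * cubeNoise n (fun δ => f δ ^ k) ε := by
    calc f ε ^ k ≤ (2 * cubeNoise n f ε) ^ k := pow_le_pow_left₀ (hf ε) (hT ε) k
      _ = 2 ^ k * cubeNoise n f ε ^ k := mul_pow _ _ _
      _ ≤ _ := by gcongr; exact cubeNoise_pow_le hf k ε
  calc f ε ^ (4 * k) = (f ε ^ k) ^ 4 := by rw [← pow_mul, mul_comm]
    _ ≤ (2 ^ k * cubeNoise n (fun δ => f δ ^ k) ε) ^ 4 :=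
      pow_le_pow_left₀ (pow_nonneg (hf ε) k) h1 4
    _ = 16 ^ k * cubeNoise n (fun δ => f δ ^ k) ε ^ 4 := by
      rw [mul_pow, ← pow_mul, mul_comm k, pow_mul]
      norm_num

lemma cubeMean_sq_le (hf : ∀ ε, 0 ≤ f ε) (hT : ∀ ε, f ε ≤ 2 * cubeNoise n f ε) :
    cubeMean (fun ε => f ε ^ 2) ≤ 16 * cubeMean f ^ 2 := by
  have h4 := cubeMean_pow_four_mul_le hf hT 1
  have h12 := cubeMean_mul_sq_le (fun ε => √(f ε)) (fun ε => √(f ε) * f ε)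
  have h23 := cubeMean_mul_sq_le f (fun ε => f ε ^ 2)
  simp only [← mul_assoc, mul_pow, Real.mul_self_sqrt (hf _), Real.sq_sqrt (hf _)] at h12
  simp only [← sq, ← pow_succ', ← pow_mul] at h12 h23
  norm_num at h4 h12 h23
  have h0 : 0 ≤ cubeMean f := cubeMean_nonneg hf
  have h3 : 0 ≤ cubeMean (fun ε => f ε ^ 3) := cubeMean_nonneg fun ε => pow_nonneg (hf ε) 3
  rcases (cubeMean_nonneg fun ε => pow_nonneg (hf ε) 2 :
    0 ≤ cubeMean (fun ε => f ε ^ 2)).eq_or_lt with h | h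
  · rw [← h]
    positivity
  · set a := cubeMean f
    set b := cubeMean (fun ε => f ε ^ 2)
    set c := cubeMean (fun ε => f ε ^ 3)
    set d := cubeMean (fun ε => f ε ^ 4)
    have : b * b ^ 3 ≤ 16 * a ^ 2 * b ^ 3 := by
      calc b * b ^ 3 = (b ^ 2) ^ 2 := by ring
        _ ≤ (a * c) ^ 2 := pow_le_pow_left₀ (by positivity) h12 2
        _ = a ^ 2 * c ^ 2 := mul_pow _ _ _
        _ ≤ a ^ 2 * (b * (16 * b ^ 2)) := by
          gcongr
          exact h23.trans (mul_le_mul_of_nonneg_left h4 h.le)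
        _ = 16 * a ^ 2 * b ^ 3 := by ring
    exact le_of_mul_le_mul_right this (by positivity)

lemma cubeMean_pow_two_pow_le (hf : ∀ ε, 0 ≤ f ε) (hT : ∀ ε, f ε ≤ 2 * cubeNoise n f ε)
    (j : ℕ) :
    cubeMean (fun ε => f ε ^ (2 ^ (j + 1))) ≤ (2 ^ (j + 2) * cubeMean f) ^ (2 ^ (j + 1)) := by
  induction j with
  | zero =>
    refine (cubeMean_sq_le hf hT).trans_eq ?_
    norm_num [mul_pow]
  | succ j ih =>
    have h := cubeMean_pow_four_mul_le hf hT (2 ^ j)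
    rw [show 4 * 2 ^ j = 2 ^ (j + 1 + 1) by ring, show 2 * 2 ^ j = 2 ^ (j + 1) by ring] at h
    refine h.trans ?_
    calc 16 ^ 2 ^ j * cubeMean (fun ε => f ε ^ 2 ^ (j + 1)) ^ 2
        ≤ 16 ^ 2 ^ j * ((2 ^ (j + 2) * cubeMean f) ^ 2 ^ (j + 1)) ^ 2 := by
          gcongr
          exact cubeMean_nonneg fun ε => pow_nonneg (hf ε) _
      _ = (2 * (2 ^ (j + 2) * cubeMean f)) ^ 2 ^ (j + 1 + 1) := by
          rw [← pow_mul, ← pow_succ, mul_pow 2, show 2 ^ (j + 1 + 1) = 4 * 2 ^ j by ring,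
            pow_mul 2 4]
          norm_num
      _ = (2 ^ (j + 1 + 2) * cubeMean f) ^ 2 ^ (j + 1 + 1) := by ring

lemma cubeMean_rpow_inv_le (hf : ∀ ε, 0 ≤ f ε) (hT : ∀ ε, f ε ≤ 2 * cubeNoise n f ε) {q : ℝ}
    (hq : 1 ≤ q) : cubeMean (fun ε => f ε ^ q) ^ (1 / q) ≤ 4 * q * cubeMean f := by
  obtain ⟨j, hjq, hqj⟩ := exists_nat_pow_near hq one_lt_two
  have h0 : 0 ≤ cubeMean f := cubeMean_nonneg hf
  have hmono := cubeMean_rpow_inv_mono hf (one_pos.trans_le hq) hqj.le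
  have hcast : ∀ y : ℝ, y ^ ((2 : ℝ) ^ (j + 1)) = y ^ (2 ^ (j + 1) : ℕ) := fun y => by
    rw [← Real.rpow_natCast y (2 ^ (j + 1)), Nat.cast_pow, Nat.cast_ofNat]
  simp only [hcast] at hmono
  refine hmono.trans ?_
  calc cubeMean (fun ε => f ε ^ 2 ^ (j + 1)) ^ (1 / (2 : ℝ) ^ (j + 1))
      ≤ ((2 ^ (j + 2) * cubeMean f) ^ 2 ^ (j + 1)) ^ (1 / (2 : ℝ) ^ (j + 1)) :=
        Real.rpow_le_rpow (cubeMean_nonneg fun ε => pow_nonneg (hf ε) _)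
          (cubeMean_pow_two_pow_le hf hT j) (by positivity)
    _ = 2 ^ (j + 2) * cubeMean f := by
        rw [← hcast, one_div, Real.rpow_rpow_inv (by positivity) (by positivity)]
    _ = 4 * 2 ^ j * cubeMean f := by ring
    _ ≤ 4 * q * cubeMean f := by gcongr

end Moments

section MetricGroup

variable {G : Type*} [CommGroup G] [MetricSpace G]

lemma dist_one_mul_le (hinv : ∀ a b c : G, dist (a * c) (b * c) = dist a b) (a b : G) :
    dist 1 (a * b) ≤ dist 1 a + dist 1 b := by
  have h := dist_triangle 1 b (a * b)
  have h' := hinv 1 a b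
  rw [one_mul] at h'
  linarith

/-- A product of signs shifted by `y ^ 2` is dominated by twice the noise average of the product
shifted by `y`. -/
lemma dist_one_signProd_le (hinv : ∀ a b c : G, dist (a * c) (b * c) = dist a b)
    (hnormed : ∀ (z : G) (m : ℕ), dist (1 : G) (z ^ m) = m * dist (1 : G) z)
    {n : ℕ} (x : Fin n → G) (y : G) (ε : Fin n → Bool) :
    dist 1 ((∏ k, x k ^ (if ε k then (1 : ℤ) else -1)) * y ^ 2) ≤
      2 * cubeNoise n (fun δ => dist 1 ((∏ k, x k ^ (if δ k then (1 : ℤ) else -1)) * y)) ε := by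
  induction n generalizing y with
  | zero =>
    simp only [cubeNoise, Finset.univ_eq_empty, Finset.prod_empty, one_mul, hnormed]
    norm_num
  | succ n ih =>
    set P := ∏ k : Fin n, x k.succ ^ (if Fin.tail ε k then (1 : ℤ) else -1) with hP
    set w := x 0 ^ (if ε 0 then (1 : ℤ) else -1) with hw
    have hw' : x 0 ^ (if (!ε 0) then (1 : ℤ) else -1) = w⁻¹ := by
      rw [hw]
      cases ε 0 <;> simp
    have h1 := ih (fun k => x k.succ) (w * y) (Fin.tail ε)
    have h2 := ih (fun k => x k.succ) (w⁻¹ * y) (Fin.tail ε)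
    have h3 := dist_one_mul_le hinv ((P * (w * y) ^ 2) ^ 3) (P * (w⁻¹ * y) ^ 2)
    have h4 : (P * (w * y) ^ 2) ^ 3 * (P * (w⁻¹ * y) ^ 2) = (w * P * y ^ 2) ^ 4 := by
      simp only [mul_pow, inv_pow, ← pow_mul]
      calc _ = (w ^ 2 * (w ^ 2)⁻¹) * (w ^ 4 * P ^ 4 * y ^ 8) := by
            simp only [pow_succ, pow_zero, one_mul]
            ac_rfl
        _ = _ := by rw [mul_inv_cancel, one_mul]
    rw [h4, hnormed, hnormed] at h3
    push_cast at h3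
    have hL : (∏ k, x k ^ (if ε k then (1 : ℤ) else -1)) = w * P := Fin.prod_univ_succ _
    have hcons : ∀ (b : Bool) (δ : Fin n → Bool),
        (∏ k, x k ^ (if (Fin.cons b δ : Fin (n + 1) → Bool) k then (1 : ℤ) else -1)) * y =
          (∏ k : Fin n, x k.succ ^ (if δ k then (1 : ℤ) else -1)) *
            (x 0 ^ (if b then (1 : ℤ) else -1) * y) := fun b δ => by
      simp only [Fin.prod_univ_succ, Fin.cons_zero, Fin.cons_succ]
      ac_rfl
    simp only [cubeNoise, hcons, hw', hL]
    linarith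

end MetricGroup

/-- Khinchin–Kahane inequality for separable abelian normed metric groups,
with constant `C_{p,q} = 1` if `q ≤ p` and `C_{p,q} = 64·q·(q/4)^{1/q}` if `q > p`.
Here `dist` is translation-invariant and `G` is normed: `dist 1 (z^n) = n · dist 1 z`.
The expectation is the uniform average over sign vectors `ε ∈ {−1,1}ⁿ`, encoded by
`ε : Fin n → Bool` with `xₖ^{εₖ} = xₖ^(if ε k then 1 else -1)`. -/
theorem khinchin_kahane_normed
    (G : Type*) [CommGroup G] [MetricSpace G] [TopologicalSpace.SeparableSpace G]
    (hinv : ∀ a b c : G, dist (a * c) (b * c) = dist a b)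
    (hnormed : ∀ (z : G) (m : ℕ), dist (1 : G) (z ^ m) = m * dist (1 : G) z)
    (n : ℕ) (x : Fin n → G) (p q : ℝ) (hp : 1 ≤ p) (hq : 1 ≤ q) :
    ((∑ ε : Fin n → Bool,
        dist (1 : G) (∏ k, x k ^ (if ε k then (1 : ℤ) else -1)) ^ q) / 2 ^ n) ^ (1 / q)
      ≤ (if q ≤ p then 1 else 64 * q * (q / 4) ^ (1 / q)) *
        ((∑ ε : Fin n → Bool,
          dist (1 : G) (∏ k, x k ^ (if ε k then (1 : ℤ) else -1)) ^ p) / 2 ^ n) ^ (1 / p) := by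
  set f : (Fin n → Bool) → ℝ :=
    fun ε => dist (1 : G) (∏ k, x k ^ (if ε k then (1 : ℤ) else -1))
  have hf : ∀ ε, 0 ≤ f ε := fun ε => dist_nonneg
  have hT : ∀ ε, f ε ≤ 2 * cubeNoise n f ε := fun ε => by
    simpa only [one_pow, mul_one] using dist_one_signProd_le hinv hnormed x 1 ε
  change cubeMean (fun ε => f ε ^ q) ^ (1 / q) ≤
    _ * cubeMean (fun ε => f ε ^ p) ^ (1 / p)
  have hq0 : 0 < q := one_pos.trans_le hq
  split_ifs with hqp
  · rw [one_mul]
    exact cubeMean_rpow_inv_mono hf hq0 hqp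
  · have hmean : cubeMean f ≤ cubeMean (fun ε => f ε ^ p) ^ (1 / p) := by
      simpa only [Real.rpow_one, one_div_one] using cubeMean_rpow_inv_mono hf one_pos hp
    have hconst : (1 / 4 : ℝ) ≤ (q / 4) ^ (1 / q) :=
      calc (1 / 4 : ℝ) = (1 / 4) ^ (1 : ℝ) := (Real.rpow_one _).symm
        _ ≤ (1 / 4) ^ (1 / q) := Real.rpow_le_rpow_of_exponent_ge (by norm_num) (by norm_num)
            ((div_le_one hq0).2 hq)
        _ ≤ (q / 4) ^ (1 / q) := Real.rpow_le_rpow (by norm_num) (by linarith) (by positivity)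
    calc cubeMean (fun ε => f ε ^ q) ^ (1 / q) ≤ 4 * q * cubeMean f :=
          cubeMean_rpow_inv_le hf hT hq
      _ ≤ 64 * q * (q / 4) ^ (1 / q) * cubeMean (fun ε => f ε ^ p) ^ (1 / p) :=
          mul_le_mul (by nlinarith) hmean (cubeMean_nonneg hf) (by positivity)
end

section
/- Let (G,·,1,d) be an abelian normed metric group and let q ∈ [1,2]. For every x ∈ G with x ≠ 1, taking n = 2 and x₁ = x₂ = x, one has equality: ( E[ d(1, x^{ε₁}·x^{ε₂})^q ] )^{1/q} = 2^{1−1/q} · E[ d(1, x^{ε₁}·x^{ε₂}) ], where E denotes the uniform average over ε ∈ {−1,1}². Consequently, for any nontrivial abelian normed metric group the constant 2^{1−1/q} in the Khinchin–Kahane inequality with p = 1 is best possible. -/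
theorem Fintype.sum_fin_two_arrow_bool {M : Type*} [AddCommMonoid M] (f : Bool → Bool → M) :
    ∑ ε : Fin 2 → Bool, f (ε 0) (ε 1) =
      f true true + f true false + (f false true + f false false) := by
  rw [← (finTwoArrowEquiv Bool).symm.sum_comp, Fintype.sum_prod_type]
  simp [finTwoArrowEquiv]

theorem dist_one_inv_of_mul_right_invariant {G : Type*} [Group G] [PseudoMetricSpace G]
    (hinv : ∀ a b c : G, dist (a * c) (b * c) = dist a b) (z : G) :
    dist 1 z⁻¹ = dist 1 z := by
  rw [← hinv 1 z⁻¹ z, one_mul, inv_mul_cancel, dist_comm]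


/-- Sharpness of the constant `2^{1−1/q}`: in any abelian normed metric
group, for `x ≠ 1`, `n = 2`, `x₁ = x₂ = x`, the Khinchin–Kahane inequality with `p = 1`
holds with equality:
`(E[d(1, x^{ε₁}·x^{ε₂})^q])^{1/q} = 2^{1−1/q} · E[d(1, x^{ε₁}·x^{ε₂})]`. -/
theorem khinchin_kahane_sharp_constant
    (G : Type*) [CommGroup G] [MetricSpace G]
    (hinv : ∀ a b c : G, dist (a * c) (b * c) = dist a b)
    (hnormed : ∀ (z : G) (m : ℕ), dist (1 : G) (z ^ m) = m * dist (1 : G) z)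
    (q : ℝ) (hq1 : 1 ≤ q) (hq2 : q ≤ 2) (x : G) (hx : x ≠ 1) :
    ((∑ ε : Fin 2 → Bool,
        dist (1 : G) (x ^ (if ε 0 then (1 : ℤ) else -1) * x ^ (if ε 1 then (1 : ℤ) else -1)) ^ q)
        / 2 ^ 2) ^ (1 / q)
      = 2 ^ (1 - 1 / q) *
        ((∑ ε : Fin 2 → Bool,
          dist (1 : G) (x ^ (if ε 0 then (1 : ℤ) else -1) * x ^ (if ε 1 then (1 : ℤ) else -1)))
          / 2 ^ 2) := by
  have hsq : dist 1 (x * x) = 2 * dist 1 x := by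
    simpa [pow_two] using hnormed x 2
  have hsq_inv : dist 1 (x⁻¹ * x⁻¹) = 2 * dist 1 x := by
    rw [← mul_inv, dist_one_inv_of_mul_right_invariant hinv, hsq]
  have hq : q ≠ 0 := by positivity
  rw [Fintype.sum_fin_two_arrow_bool fun a b =>
      dist (1 : G) (x ^ (if a then (1 : ℤ) else -1) * x ^ (if b then (1 : ℤ) else -1)) ^ q,
    Fintype.sum_fin_two_arrow_bool fun a b =>
      dist (1 : G) (x ^ (if a then (1 : ℤ) else -1) * x ^ (if b then (1 : ℤ) else -1))]
  simp only [if_true, Bool.false_eq_true, if_false, zpow_one, zpow_neg, mul_inv_cancel,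
    inv_mul_cancel, dist_self, hsq, hsq_inv, Real.zero_rpow hq, add_zero, zero_add]
  have hhalf : ((2 * dist 1 x) ^ q + (2 * dist 1 x) ^ q) / 2 ^ 2 = (2 * dist 1 x) ^ q / 2 := by
    ring
  rw [hhalf, Real.div_rpow (by positivity) (by positivity), one_div,
    Real.rpow_rpow_inv (by positivity) hq, Real.rpow_sub two_pos, Real.rpow_one]
  ring
end

section
/- Let (G,·,1,d) be a separable abelian metric group (not necessarily normed), let n ∈ ℕ, x₁,…,xₙ ∈ G, and let E denote the uniform average over sign vectors ε ∈ {−1,1}ⁿ. Let p, q ∈ [1,∞) and let l ∈ ℕ be the unique positive integer with 2^{l−1} ≤ q < 2^{l}. Then ( E[ d(1, ∏ₖ xₖ^{2^{l}·εₖ})^q ] )^{1/q} ≤ 64·q²·(q/4)^{1/q} · ( E[ d(1, ∏ₖ xₖ^{εₖ})^p ] )^{1/p}. -/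
section SignAverage

open Set

variable {G : Type*} [CommGroup G]

/-- The average of `f (∏ yₖ ^ εₖ)` over independent uniform signs, with `y` ranging over a list. -/
noncomputable def signAvg : List G → (G → ℝ) → ℝ
  | [], f => f 1
  | y :: L, f => (signAvg L (fun s => f (y * s)) + signAvg L (fun s => f (y⁻¹ * s))) / 2

/-- The probability that the random signed partial products of a list, started at `a`,
visit the set `A`. -/
noncomputable def signHit (A : Set G) : List G → G → ℝ
  | [], a => A.indicator 1 a
  | y :: L, a =>
    open Classical in
    if a ∈ A then 1 else (signHit A L (a * y) + signHit A L (a * y⁻¹)) / 2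

lemma signAvg_mono (L : List G) {f g : G → ℝ} (h : ∀ s, f s ≤ g s) :
    signAvg L f ≤ signAvg L g := by
  induction L generalizing f g with
  | nil => exact h 1
  | cons y L ih =>
    have h₁ := ih (fun s => h (y * s))
    have h₂ := ih (fun s => h (y⁻¹ * s))
    simp only [signAvg]
    linarith

lemma signAvg_const (L : List G) (c : ℝ) : signAvg L (fun _ => c) = c := by
  induction L with
  | nil => rfl
  | cons y L ih => simp [signAvg, ih]

lemma signAvg_add (L : List G) (f g : G → ℝ) :
    signAvg L (fun s => f s + g s) = signAvg L f + signAvg L g := by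
  induction L generalizing f g with
  | nil => rfl
  | cons y L ih => simp only [signAvg, ih]; ring

lemma signAvg_const_mul (L : List G) (c : ℝ) (f : G → ℝ) :
    signAvg L (fun s => c * f s) = c * signAvg L f := by
  induction L generalizing f with
  | nil => rfl
  | cons y L ih => simp only [signAvg, ih]; ring

lemma signAvg_inv (L : List G) (f : G → ℝ) :
    signAvg L (fun s => f s⁻¹) = signAvg L f := by
  induction L generalizing f with
  | nil => simp [signAvg]
  | cons y L ih =>
    have h₁ := ih (fun s => f (y * s))
    have h₂ := ih (fun s => f (y⁻¹ * s))
    simp only [signAvg, mul_inv, inv_inv] at *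
    rw [h₁, h₂, add_comm]

lemma signAvg_append (Q L : List G) (f : G → ℝ) :
    signAvg (Q ++ L) f = signAvg L (fun r => signAvg Q (fun s => f (r * s))) := by
  induction Q generalizing f with
  | nil => simp [signAvg]
  | cons y Q ih =>
    have h := signAvg_add L (fun r => 2⁻¹ * signAvg Q (fun s => f (y * (r * s))))
      (fun r => 2⁻¹ * signAvg Q (fun s => f (y⁻¹ * (r * s))))
    rw [signAvg_const_mul, signAvg_const_mul] at h
    simp only [List.cons_append, signAvg, ih]
    rw [show ∀ u v : ℝ, (u + v) / 2 = 2⁻¹ * u + 2⁻¹ * v by intros; ring, ← h]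
    congr 1
    funext r
    simp only [mul_left_comm r]
    ring

lemma signAvg_map_pow (L : List G) (m : ℕ) (f : G → ℝ) :
    signAvg (L.map (· ^ m)) f = signAvg L (fun s => f (s ^ m)) := by
  induction L generalizing f with
  | nil => simp [signAvg]
  | cons y L ih => simp [signAvg, ih, mul_pow]

lemma signAvg_ofFn {n : ℕ} (x : Fin n → G) (f : G → ℝ) :
    signAvg (List.ofFn x) f =
      (∑ ε : Fin n → Bool, f (∏ k, x k ^ (if ε k then (1 : ℤ) else -1))) / 2 ^ n := by
  induction n generalizing f with
  | zero => simp [signAvg]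
  | succ n ih =>
    rw [List.ofFn_succ, signAvg, ih, ih,
      ← (Fin.consEquiv (fun _ : Fin (n + 1) => Bool)).sum_comp, Fintype.sum_prod_type,
      Fintype.sum_bool]
    simp only [Fin.consEquiv, Equiv.coe_fn_mk, Fin.prod_univ_succ, Fin.cons_zero, Fin.cons_succ]
    simp only [if_true, Bool.false_eq_true, if_false, zpow_one, zpow_neg]
    rw [← add_div, div_div, pow_succ]


variable {N : G → ℝ}

lemma one_le_two_mul_signAvg (hN : ∀ a b, N (a * b) ≤ N a + N b) (L : List G)
    {a : G} {t : ℝ} (ha : 2 * t < N (a ^ 2)) :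
    1 ≤ 2 * signAvg L (fun s => {b | t < N b}.indicator 1 (a * s)) := by
  have h : signAvg L (fun _ => 1) ≤ signAvg L (fun s =>
      {b | t < N b}.indicator 1 (a * s) + {b | t < N b}.indicator 1 (a * s⁻¹)) := by
    refine signAvg_mono L fun s => ?_
    have hs := hN (a * s) (a * s⁻¹)
    rw [show a * s * (a * s⁻¹) = a ^ 2 by rw [mul_mul_mul_comm, mul_inv_cancel, mul_one, sq]] at hs
    simp only [indicator_apply, mem_ofPred_eq, Pi.one_apply]
    split_ifs <;> norm_num
    linarith
  rw [signAvg_const, signAvg_add,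
    signAvg_inv L (fun s => {b | t < N b}.indicator 1 (a * s))] at h
  linarith

/-- A Lévy-type maximal inequality. -/
lemma signHit_le (hN : ∀ a b, N (a * b) ≤ N a + N b) (L : List G) (a : G) (t : ℝ) :
    signHit {b | 2 * t < N (b ^ 2)} L a ≤
      2 * signAvg L (fun s => {b | t < N b}.indicator 1 (a * s)) := by
  induction L generalizing a with
  | nil =>
    by_cases ha : 2 * t < N (a ^ 2)
    · simpa [signHit, ha] using one_le_two_mul_signAvg hN [] ha
    · simp only [signHit, signAvg, indicator_apply, mem_ofPred_eq, ha, if_false, Pi.one_apply]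
      split_ifs <;> norm_num
  | cons y L ih =>
    by_cases ha : 2 * t < N (a ^ 2)
    · simpa [signHit, ha] using one_le_two_mul_signAvg hN (y :: L) ha
    · have h₁ := ih (a * y)
      have h₂ := ih (a * y⁻¹)
      simp only [signHit, mem_ofPred_eq, ha, if_false, signAvg]
      simp only [mul_assoc] at h₁ h₂
      linarith

lemma signAvg_suffix_le (hN : ∀ a b, N (a * b) ≤ N a + N b) {L' L : List G} (h : L' <:+ L) (t : ℝ) :
    signAvg L' (fun s => {b | 2 * t < N (b ^ 2)}.indicator 1 s) ≤
      2 * signAvg L (fun s => {b | t < N b}.indicator 1 s) := by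
  obtain ⟨Q, rfl⟩ := h
  rw [signAvg_append, ← signAvg_const_mul]
  refine signAvg_mono L' fun r => ?_
  by_cases hr : 2 * t < N (r ^ 2)
  · simpa [hr] using one_le_two_mul_signAvg hN Q hr
  · simp only [indicator_apply, mem_ofPred_eq, hr, if_false, Pi.one_apply]
    have := signAvg_mono Q (f := fun _ => 0) (g := fun s => if t < N (r * s) then (1 : ℝ) else 0)
      (fun s => by split_ifs <;> norm_num)
    rw [signAvg_const] at this
    linarith

lemma signHit_eq_one {A : Set G} (L : List G) {a : G} (ha : a ∈ A) : signHit A L a = 1 := by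
  cases L <;> simp [signHit, ha]

/-- Stopping at the first time the partial products become large. -/
lemma signAvg_le_mul_signHit (hN : ∀ a b, N (a * b) ≤ N a + N b)
    (hinv : ∀ a, N a⁻¹ = N a) (L : List G) {β t : ℝ} (ht : 0 ≤ t)
    (hβ : ∀ L', L' <:+ L →
      signAvg L' (fun s => {b | 2 * t < N (b ^ 2)}.indicator 1 s) ≤ β)
    {a : G} (ha : ¬ 2 * t < N (a ^ 2)) :
    signAvg L (fun s => {b | 4 * t < N (b ^ 2)}.indicator 1 (a * s)) ≤
      β * signHit {b | 2 * t < N (b ^ 2)} L a := by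
  induction L generalizing a with
  | nil =>
    have h4 : ¬ 4 * t < N (a ^ 2) := by linarith
    simp [signAvg, signHit, ha, h4]
  | cons y L ih =>
    have hflip : signAvg L (fun s => {b | 2 * t < N (b ^ 2)}.indicator 1 (y⁻¹ * s)) =
        signAvg L (fun s => {b | 2 * t < N (b ^ 2)}.indicator 1 (y * s)) := by
      rw [← signAvg_inv]
      congr 1
      funext s
      simp only [← mul_inv, indicator_apply, mem_ofPred_eq, inv_pow, hinv, Pi.one_apply]
    have hcons := hβ (y :: L) List.suffix_rfl
    simp only [signAvg, hflip, add_self_div_two] at hcons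
    have step (z : G) (hz : signAvg L (fun s =>
        {b | 2 * t < N (b ^ 2)}.indicator 1 (z * s)) ≤ β) :
        signAvg L (fun s => {b | 4 * t < N (b ^ 2)}.indicator 1 (a * (z * s))) ≤
          β * signHit {b | 2 * t < N (b ^ 2)} L (a * z) := by
      by_cases haz : 2 * t < N ((a * z) ^ 2)
      · rw [signHit_eq_one L haz, mul_one]
        refine (signAvg_mono L fun s => ?_).trans hz
        have hs := hN (a ^ 2) ((z * s) ^ 2)
        rw [← mul_pow] at hs
        simp only [indicator_apply, mem_ofPred_eq, Pi.one_apply]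
        split_ifs <;> norm_num
        linarith
      · simpa only [mul_assoc] using
          ih (fun L' h => hβ L' (h.trans (List.suffix_cons y L))) haz
    have h₁ := step y hcons
    have h₂ := step y⁻¹ (hflip.trans_le hcons)
    simp only [signHit, mem_ofPred_eq, ha, if_false, signAvg]
    linarith

lemma signAvg_tail_sq_le (hN : ∀ a b, N (a * b) ≤ N a + N b)
    (hone : N 1 = 0) (hinv : ∀ a, N a⁻¹ = N a) (L : List G) {t : ℝ}
    (ht : 0 ≤ t) :
    signAvg L (fun s => {b | 4 * t < N (b ^ 2)}.indicator 1 s) ≤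
      4 * signAvg L (fun s => {b | t < N b}.indicator 1 s) ^ 2 := by
  have hpos := signAvg_mono L (f := fun _ => 0)
    (g := fun s => {b | t < N b}.indicator 1 s)
    (fun s => indicator_nonneg (fun _ _ => zero_le_one) s)
  rw [signAvg_const] at hpos
  have h₁ := signAvg_le_mul_signHit hN hinv L ht (fun L' h => signAvg_suffix_le hN h t)
    (a := 1) (by simpa [hone] using ht)
  have h₂ := signHit_le hN L 1 t
  simp only [one_mul] at h₁ h₂
  refine h₁.trans ((mul_le_mul_of_nonneg_left h₂ (by positivity)).trans (le_of_eq ?_))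
  ring

lemma signAvg_tail_pow_le (hN : ∀ a b, N (a * b) ≤ N a + N b)
    (hone : N 1 = 0) (hinv : ∀ a, N a⁻¹ = N a) (L : List G) {t : ℝ}
    (ht : 0 ≤ t) (l : ℕ) :
    4 * signAvg L (fun s => {b | 4 ^ l * t < N (b ^ 2 ^ l)}.indicator 1 s) ≤
      (4 * signAvg L (fun s => {b | t < N b}.indicator 1 s)) ^ 2 ^ l := by
  induction l with
  | zero => simp
  | succ l ih =>
    have h := signAvg_tail_sq_le hN hone hinv (L.map (· ^ 2 ^ l)) (t := 4 ^ l * t)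
      (by positivity)
    rw [signAvg_map_pow, signAvg_map_pow] at h
    have hpos := signAvg_mono L (f := fun _ => 0)
      (g := fun s => {b | 4 ^ l * t < N (b ^ 2 ^ l)}.indicator 1 s)
      (fun s => indicator_nonneg (fun _ _ => zero_le_one) s)
    rw [signAvg_const] at hpos
    have h₁ := pow_le_pow_left₀ (by positivity) ih 2
    rw [← pow_mul, ← pow_succ] at h₁
    refine le_trans ?_ h₁
    simp only [indicator_apply, mem_ofPred_eq, Pi.one_apply, ← pow_mul, ← pow_succ,
      ← mul_assoc, ← pow_succ'] at h ⊢
    linarith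

end SignAverage

section MomentComparison

open MeasureTheory Set
open scoped ENNReal

lemma lintegral_rpow_le_of_meas_lt_le {Ω : Type*} [MeasurableSpace Ω] (μ : Measure Ω)
    [IsProbabilityMeasure μ] {X Y : Ω → ℝ} (hX : ∀ ω, 0 ≤ X ω) (hY : ∀ ω, 0 ≤ Y ω)
    (hXm : Measurable X) (hYm : Measurable Y) (hYi : ∫⁻ ω, ENNReal.ofReal (Y ω) ∂μ ≠ ∞)
    {q r : ℝ} (hq : 1 ≤ q) (hqr : q ≤ r) {C : ℝ≥0∞} (hC : C ≠ ∞)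
    (h : ∀ t, 0 < t → μ {ω | t < X ω} ≤ C * μ {ω | t < Y ω} ^ r) :
    ∫⁻ ω, ENNReal.ofReal (X ω ^ q) ∂μ ≤
      ENNReal.ofReal q * C * (∫⁻ ω, ENNReal.ofReal (Y ω) ∂μ) ^ q := by
  set m := ∫⁻ ω, ENNReal.ofReal (Y ω) ∂μ with hm
  have hq' : 0 ≤ q - 1 := by linarith
  have split (a : ℝ≥0∞) : a ^ q = a * a ^ (q - 1) := by
    have h := ENNReal.rpow_add_of_nonneg (x := a) 1 (q - 1) zero_le_one hq'
    rwa [add_sub_cancel, ENNReal.rpow_one] at h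
  rw [lintegral_rpow_eq_lintegral_meas_lt_mul μ (ae_of_all _ hX) hXm.aemeasurable (by linarith),
    mul_assoc]
  gcongr
  calc ∫⁻ t in Ioi 0, μ {ω | t < X ω} * ENNReal.ofReal (t ^ (q - 1))
      ≤ ∫⁻ t in Ioi 0, C * (μ {ω | t < Y ω} * m ^ (q - 1)) := by
        refine setLIntegral_mono' measurableSet_Ioi fun t ht => ?_
        have ht : 0 < t := ht
        set a := μ {ω | t < Y ω} with ha
        have markov : a * ENNReal.ofReal t ≤ m := by
          rw [mul_comm]
          refine le_trans ?_ (mul_meas_ge_le_lintegral hYm.ennreal_ofReal (ENNReal.ofReal t))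
          gcongr
          exact measure_mono fun ω hω => ENNReal.ofReal_le_ofReal (le_of_lt hω)
        calc μ {ω | t < X ω} * ENNReal.ofReal (t ^ (q - 1))
            ≤ C * a ^ r * ENNReal.ofReal t ^ (q - 1) := by
              rw [ENNReal.ofReal_rpow_of_pos ht]
              gcongr
              exact h t ht
          _ ≤ C * a ^ q * ENNReal.ofReal t ^ (q - 1) := by
              gcongr C * ?_ * _
              exact ENNReal.rpow_le_rpow_of_exponent_ge prob_le_one hqr
          _ = C * (a * (a * ENNReal.ofReal t) ^ (q - 1)) := by
              rw [split, ENNReal.mul_rpow_of_nonneg _ _ hq']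
              ring
          _ ≤ C * (a * m ^ (q - 1)) := by gcongr
    _ = C * m ^ q := by
        rw [lintegral_const_mul' _ _ hC,
          lintegral_mul_const' _ _ (ENNReal.rpow_ne_top_of_nonneg hq' hYi),
          ← lintegral_eq_lintegral_meas_lt μ (ae_of_all _ hY) hYm.aemeasurable, ← hm, split]

lemma sum_rpow_div_card_le_of_tail_le {Ω : Type*} [Fintype Ω] [Nonempty Ω] {X Y : Ω → ℝ}
    (hX : ∀ ω, 0 ≤ X ω) (hY : ∀ ω, 0 ≤ Y ω) {q r C : ℝ} (hq : 1 ≤ q) (hqr : q ≤ r)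
    (hC : 0 ≤ C)
    (h : ∀ t, 0 < t → (∑ ω, {ω | t < X ω}.indicator (1 : Ω → ℝ) ω) / Fintype.card Ω ≤
      C * ((∑ ω, {ω | t < Y ω}.indicator (1 : Ω → ℝ) ω) / Fintype.card Ω) ^ r) :
    (∑ ω, X ω ^ q) / Fintype.card Ω ≤ q * C * ((∑ ω, Y ω) / Fintype.card Ω) ^ q := by
  let _ : MeasurableSpace Ω := ⊤
  let μ : Measure Ω := (Fintype.card Ω : ℝ≥0∞)⁻¹ • Measure.count
  have hcard : (0 : ℝ) < Fintype.card Ω := by exact_mod_cast Fintype.card_pos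
  have hμ (f : Ω → ℝ) (hf : ∀ ω, 0 ≤ f ω) :
      ∫⁻ ω, ENNReal.ofReal (f ω) ∂μ = ENNReal.ofReal ((∑ ω, f ω) / Fintype.card Ω) := by
    rw [lintegral_smul_measure, lintegral_count, tsum_fintype,
      ← ENNReal.ofReal_sum_of_nonneg fun ω _ => hf ω, div_eq_inv_mul,
      ENNReal.ofReal_mul (by positivity), ENNReal.ofReal_inv_of_pos hcard,
      ENNReal.ofReal_natCast, smul_eq_mul]
  have hind (A : Set Ω) (ω : Ω) : 0 ≤ A.indicator (1 : Ω → ℝ) ω :=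
    indicator_nonneg (fun _ _ => zero_le_one) ω
  have hμs (A : Set Ω) : μ A = ENNReal.ofReal ((∑ ω, A.indicator (1 : Ω → ℝ) ω) /
      Fintype.card Ω) := by
    rw [← hμ _ (hind A), ← lintegral_indicator_one MeasurableSpace.measurableSet_top]
    congr 1
    funext ω
    by_cases hω : ω ∈ A <;> simp [hω]
  have hP : IsProbabilityMeasure μ := ⟨by simp [hμs]⟩
  have hsum {f : Ω → ℝ} (hf : ∀ ω, 0 ≤ f ω) : 0 ≤ (∑ ω, f ω) / Fintype.card Ω :=
    div_nonneg (Finset.sum_nonneg fun ω _ => hf ω) hcard.le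
  have key := lintegral_rpow_le_of_meas_lt_le μ hX hY measurable_from_top measurable_from_top
    (by rw [hμ Y hY]; exact ENNReal.ofReal_ne_top) hq hqr (C := ENNReal.ofReal C)
    ENNReal.ofReal_ne_top (fun t ht => by
      rw [hμs, hμs, ENNReal.ofReal_rpow_of_nonneg (hsum (hind _)) (by linarith),
        ← ENNReal.ofReal_mul hC]
      exact ENNReal.ofReal_le_ofReal (h t ht))
  rw [hμ _ (fun ω => Real.rpow_nonneg (hX ω) q), hμ Y hY,
    ENNReal.ofReal_rpow_of_nonneg (hsum hY) (by linarith), ← ENNReal.ofReal_mul (by linarith),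
    ← ENNReal.ofReal_mul (by positivity)] at key
  exact (ENNReal.ofReal_le_ofReal_iff
    (mul_nonneg (by positivity) (Real.rpow_nonneg (hsum hY) q))).1 key

end MomentComparison


/-- Khinchin–Kahane inequality for arbitrary separable abelian metric groups
(not necessarily normed): with `l ∈ ℕ` the unique positive integer satisfying
`2^{l−1} ≤ q < 2^l`,
`(E[d(1, ∏ₖ xₖ^{2^l·εₖ})^q])^{1/q} ≤ 64·q²·(q/4)^{1/q} · (E[d(1, ∏ₖ xₖ^{εₖ})^p])^{1/p}`. -/
theorem khinchin_kahane_general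
    (G : Type*) [CommGroup G] [MetricSpace G] [TopologicalSpace.SeparableSpace G]
    (hinv : ∀ a b c : G, dist (a * c) (b * c) = dist a b)
    (n : ℕ) (x : Fin n → G) (p q : ℝ) (hp : 1 ≤ p) (hq : 1 ≤ q)
    (l : ℕ) (hl : 1 ≤ l) (hlq : (2 : ℝ) ^ (l - 1) ≤ q) (hql : q < (2 : ℝ) ^ l) :
    ((∑ ε : Fin n → Bool,
        dist (1 : G) (∏ k, x k ^ ((2 : ℤ) ^ l * (if ε k then (1 : ℤ) else -1))) ^ q)
        / 2 ^ n) ^ (1 / q)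
      ≤ 64 * q ^ 2 * (q / 4) ^ (1 / q) *
        ((∑ ε : Fin n → Bool,
          dist (1 : G) (∏ k, x k ^ (if ε k then (1 : ℤ) else -1)) ^ p) / 2 ^ n) ^ (1 / p) := by
  let S : (Fin n → Bool) → G := fun ε => ∏ k, x k ^ (if ε k then (1 : ℤ) else -1)
  have hS (ε : Fin n → Bool) :
      ∏ k, x k ^ ((2 : ℤ) ^ l * (if ε k then (1 : ℤ) else -1)) = S ε ^ 2 ^ l := by
    rw [← Finset.prod_pow]
    refine Finset.prod_congr rfl fun k _ => ?_
    rw [mul_comm, zpow_mul, ← zpow_natCast]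
    norm_cast
  simp only [hS]
  change _ ≤ 64 * q ^ 2 * (q / 4) ^ (1 / q) *
    ((∑ ε, dist 1 (S ε) ^ p) / 2 ^ n) ^ (1 / p)
  have hN (a b : G) : dist 1 (a * b) ≤ dist 1 a + dist 1 b := by
    refine (dist_triangle 1 b (a * b)).trans_eq ?_
    have h := hinv 1 a b
    rw [one_mul] at h
    rw [h, add_comm]
  have hNinv (a : G) : dist 1 a⁻¹ = dist 1 a := by
    rw [← hinv 1 a⁻¹ a, one_mul, inv_mul_cancel, dist_comm]
  have hcard : (Fintype.card (Fin n → Bool) : ℝ) = 2 ^ n := by simp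
  have hq0 : 0 < q := by linarith
  set m := (∑ ε, dist 1 (S ε)) / 2 ^ n with hm
  have hm0 : 0 ≤ m := by positivity
  have hmean : m ≤ ((∑ ε, dist 1 (S ε) ^ p) / 2 ^ n) ^ (1 / p) := by
    have h := Real.arith_mean_le_rpow_mean Finset.univ (fun _ => ((2 : ℝ) ^ n)⁻¹)
      (fun ε => dist 1 (S ε)) (fun _ _ => by positivity) (by simp)
      (fun _ _ => dist_nonneg) hp
    rw [hm, Finset.sum_div, Finset.sum_div]
    simpa only [← div_eq_inv_mul] using h
  have moment := sum_rpow_div_card_le_of_tail_le (X := fun ε => dist 1 (S ε ^ 2 ^ l) / 4 ^ l)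
    (Y := fun ε => dist 1 (S ε)) (fun ε => by positivity) (fun ε => dist_nonneg) hq hql.le
    (C := 4 ^ (2 : ℝ) ^ l / 4) (by positivity) (fun t ht => by
      have h := signAvg_tail_pow_le hN (dist_self 1) hNinv (List.ofFn x) ht.le l
      rw [signAvg_ofFn, signAvg_ofFn, mul_pow] at h
      rw [show (2 : ℝ) ^ l = (2 ^ l : ℕ) by push_cast; rfl, Real.rpow_natCast,
        Real.rpow_natCast]
      simp only [hcard, lt_div_iff₀' (show (0 : ℝ) < 4 ^ l by positivity)]
      simp only [Set.indicator_apply, Set.mem_ofPred_eq, Pi.one_apply] at h ⊢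
      rw [div_mul_eq_mul_div, le_div_iff₀' (by norm_num)]
      exact h)
  simp only [hcard, ← hm] at moment
  simp only [Real.div_rpow dist_nonneg (show (0 : ℝ) ≤ 4 ^ l by positivity)] at moment
  rw [← Finset.sum_div, div_right_comm, div_le_iff₀ (by positivity)] at moment
  have h4l : (4 : ℝ) ^ l ≤ 4 * q ^ 2 := by
    obtain ⟨j, rfl⟩ : ∃ j, l = j + 1 := ⟨l - 1, by omega⟩
    rw [Nat.add_sub_cancel] at hlq
    have h := pow_le_pow_left₀ (by positivity) hlq 2
    rw [← pow_mul, mul_comm, pow_mul] at h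
    norm_num at h
    rw [pow_succ]
    linarith
  have h16 : ((4 : ℝ) ^ (2 : ℝ) ^ l) ^ (1 / q) ≤ 16 := by
    rw [← Real.rpow_mul (by norm_num)]
    have h2 : (2 : ℝ) ^ l * (1 / q) ≤ 2 := by
      obtain ⟨j, rfl⟩ : ∃ j, l = j + 1 := ⟨l - 1, by omega⟩
      rw [Nat.add_sub_cancel] at hlq
      rw [mul_one_div, div_le_iff₀ hq0, pow_succ]
      linarith
    refine (Real.rpow_le_rpow_of_exponent_le (by norm_num) h2).trans_eq ?_
    norm_num
  calc ((∑ ε, dist 1 (S ε ^ 2 ^ l) ^ q) / 2 ^ n) ^ (1 / q)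
      ≤ (q * (4 ^ (2 : ℝ) ^ l / 4) * m ^ q * (4 ^ l) ^ q) ^ (1 / q) := by gcongr
    _ = ((q / 4) * 4 ^ (2 : ℝ) ^ l * (m * 4 ^ l) ^ q) ^ (1 / q) := by
        rw [Real.mul_rpow hm0 (by positivity)]
        ring_nf
    _ = (q / 4) ^ (1 / q) * (4 ^ (2 : ℝ) ^ l) ^ (1 / q) * (m * 4 ^ l) := by
        rw [Real.mul_rpow (by positivity) (by positivity),
          Real.mul_rpow (by positivity) (by positivity), one_div,
          Real.rpow_rpow_inv (by positivity) hq0.ne']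
    _ ≤ (q / 4) ^ (1 / q) * 16 *
        (((∑ ε, dist 1 (S ε) ^ p) / 2 ^ n) ^ (1 / p) * (4 * q ^ 2)) := by gcongr
    _ = _ := by ring
end

section
/- Let (G,·,d) be a metric semigroup. If b ∈ G is idempotent (b·b = b), then b is a two-sided identity for G, i.e. b·a = a and a·b = a for all a ∈ G. In particular, G has at most one idempotent element. -/
/-- In a metric semigroup, any idempotent is a two-sided identity; in
particular there is at most one idempotent. -/
theorem metric_semigroup_idempotent_is_identity
    (G : Type*) [Semigroup G] [MetricSpace G]
    (hinv : ∀ a b c : G, dist (a * c) (b * c) = dist a b ∧ dist (c * a) (c * b) = dist a b) :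
    (∀ b : G, b * b = b → ∀ a : G, b * a = a ∧ a * b = a) ∧
    (∀ b b' : G, b * b = b → b' * b' = b' → b = b') := by
  have key : ∀ b : G, b * b = b → ∀ a : G, b * a = a ∧ a * b = a := by
    intro b hb a
    constructor
    · have h := (hinv (b * a) a b).2
      rw [← mul_assoc, hb, dist_self] at h
      exact dist_eq_zero.mp h.symm
    · have h := (hinv (a * b) a b).1
      rw [mul_assoc, hb, dist_self] at h
      exact dist_eq_zero.mp h.symm
  exact ⟨key, fun b b' hb hb' => (key b' hb' b).2.symm.trans (key b hb b').1⟩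
end

section
/- Let (G,·,1,d) be an abelian normed metric group, n ∈ ℕ, x₁,…,xₙ ∈ G, and let E denote the uniform average over sign vectors ε ∈ {−1,1}ⁿ. Write Pₙ(ε) := d(1, ∏ₖ xₖ^{εₖ}). Then E[Pₙ²] ≤ 2·( E[Pₙ] )², i.e. ( E[Pₙ²] )^{1/2} ≤ √2 · E[Pₙ]. -/
/-- The sum over the Boolean cube of `f` against the sum of its values at neighbouring vertices. -/
def cubeAdjForm {n : ℕ} (f : (Fin n → Bool) → ℝ) : ℝ :=
  ∑ ε, ∑ k, f ε * f (Function.update ε k (!ε k))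

theorem sum_cube_succ {n : ℕ} (F : (Fin (n + 1) → Bool) → ℝ) :
    ∑ ε, F ε = ∑ ε, F (Fin.cons true ε) + ∑ ε, F (Fin.cons false ε) := by
  rw [← (Fin.consEquiv (fun _ : Fin (n + 1) => Bool)).sum_comp F, Fintype.sum_prod_type,
    Fintype.sum_bool]
  rfl

theorem cubeAdjForm_succ {n : ℕ} (f : (Fin (n + 1) → Bool) → ℝ) :
    cubeAdjForm f = cubeAdjForm (fun ε => f (Fin.cons true ε))
      + cubeAdjForm (fun ε => f (Fin.cons false ε))
      + 2 * ∑ ε, f (Fin.cons true ε) * f (Fin.cons false ε) := by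
  unfold cubeAdjForm
  rw [sum_cube_succ]
  simp only [Fin.sum_univ_succ, Fin.cons_zero, Fin.cons_succ, Fin.update_cons_zero,
    ← Fin.cons_update, Bool.not_true, Bool.not_false, Finset.sum_add_distrib]
  rw [Finset.sum_congr rfl (fun ε _ => mul_comm (f (Fin.cons false ε)) (f (Fin.cons true ε)))]
  ring

theorem cubeAdjForm_parallelogram {n : ℕ} (a b : (Fin n → Bool) → ℝ) :
    cubeAdjForm (fun ε => a ε + b ε) + cubeAdjForm (fun ε => a ε - b ε)
      = 2 * cubeAdjForm a + 2 * cubeAdjForm b := by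
  simp only [cubeAdjForm, Finset.mul_sum, ← Finset.sum_add_distrib]
  refine Finset.sum_congr rfl fun ε _ => Finset.sum_congr rfl fun k _ => ?_
  ring

theorem sum_cube_not {n : ℕ} (F : (Fin n → Bool) → ℝ) :
    ∑ ε : Fin n → Bool, F (fun k => !ε k) = ∑ ε, F ε :=
  Equiv.sum_comp (Function.Involutive.toPerm (fun (ε : Fin n → Bool) k => !ε k)
    (fun ε => by funext k; simp)) F

theorem not_cons {n : ℕ} (b : Bool) (ε : Fin n → Bool) :
    (fun k => !(Fin.cons b ε : Fin (n + 1) → Bool) k) = Fin.cons (!b) (fun k => !ε k) := by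
  funext k
  refine Fin.cases ?_ (fun i => ?_) k <;> simp

theorem sq_sum_cube_le {n : ℕ} (h : (Fin n → Bool) → ℝ) :
    2 * (∑ ε, h ε) ^ 2 ≤ 2 ^ n * (∑ ε, h ε ^ 2 + ∑ ε, h ε * h (fun k => !ε k)) := by
  have key := sq_sum_le_card_mul_sum_sq (s := Finset.univ)
    (f := fun ε : Fin n → Bool => h ε + h (fun k => !ε k))
  simp only [add_sq, Finset.sum_add_distrib, mul_assoc, ← Finset.mul_sum] at key
  rw [sum_cube_not h, sum_cube_not (fun ε => h ε ^ 2)] at key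
  simp only [Finset.card_univ, Fintype.card_fun, Fintype.card_bool, Fintype.card_fin,
    Nat.cast_pow, Nat.cast_ofNat] at key
  linarith

/-- A Poincaré inequality on the Boolean cube: the even part of `f` has spectral gap `2`, its odd
part has spectral gap `1`. -/
theorem cube_poincare : ∀ {n : ℕ} (f : (Fin n → Bool) → ℝ),
    2 ^ n * (3 * ∑ ε, f ε ^ 2 + ∑ ε, f ε * f (fun k => !ε k)) - 4 * (∑ ε, f ε) ^ 2
      ≤ 2 ^ n * (n * ∑ ε, f ε ^ 2 - cubeAdjForm f) := by
  intro n
  induction n with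
  | zero =>
    intro f
    have h : ∀ ε : Fin 0 → Bool, f ε = f default := fun ε => by rw [Subsingleton.elim ε default]
    simp only [cubeAdjForm, h]
    simp
    nlinarith
  | succ n ih =>
    intro f
    obtain ⟨a, ha⟩ : ∃ a : (Fin n → Bool) → ℝ, ∀ ε, f (Fin.cons true ε) = a ε :=
      ⟨_, fun _ => rfl⟩
    obtain ⟨b, hb⟩ : ∃ b : (Fin n → Bool) → ℝ, ∀ ε, f (Fin.cons false ε) = b ε :=
      ⟨_, fun _ => rfl⟩
    have h1 := ih (fun ε => a ε + b ε)
    have h2 := ih (fun ε => a ε - b ε)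
    have h3 := sq_sum_cube_le (fun ε => a ε - b ε)
    have h4 := cubeAdjForm_parallelogram a b
    rw [cubeAdjForm_succ, sum_cube_succ, sum_cube_succ, sum_cube_succ]
    simp only [not_cons, Bool.not_true, Bool.not_false, ha, hb]
    simp only [add_sq, sub_sq, add_mul, mul_add, sub_mul, mul_sub, Finset.sum_add_distrib,
      Finset.sum_sub_distrib, mul_assoc, ← Finset.mul_sum] at h1 h2 h3
    push_cast
    rw [pow_succ]
    have h5 : (2 : ℝ) ^ n * cubeAdjForm (fun ε => a ε - b ε)
      = 2 ^ n * (2 * cubeAdjForm a + 2 * cubeAdjForm b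
          - cubeAdjForm (fun ε => a ε + b ε)) := by rw [← h4]; ring
    nlinarith [h1, h2, h3, h5]

theorem dist_one_prod_le {G ι : Type*} [CommGroup G] [MetricSpace G]
    (hinv : ∀ a b c : G, dist (a * c) (b * c) = dist a b) (s : Finset ι) (y : ι → G) :
    dist (1 : G) (∏ k ∈ s, y k) ≤ ∑ k ∈ s, dist (1 : G) (y k) := by
  classical
  induction s using Finset.induction_on with
  | empty => simp
  | insert i s hi ih =>
    rw [Finset.prod_insert hi, Finset.sum_insert hi]
    have h1 := dist_triangle (1 : G) (∏ k ∈ s, y k) (y i * ∏ k ∈ s, y k)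
    have h2 := hinv 1 (y i) (∏ k ∈ s, y k)
    rw [one_mul] at h2
    linarith

theorem signed_prod_not {G : Type*} [CommGroup G] {n : ℕ} (x : Fin n → G) (ε : Fin n → Bool) :
    ∏ k, x k ^ (if !ε k then (1 : ℤ) else -1)
      = (∏ k, x k ^ (if ε k then (1 : ℤ) else -1))⁻¹ := by
  rw [← Finset.prod_inv_distrib]
  refine Finset.prod_congr rfl fun k _ => ?_
  cases ε k <;> simp

theorem signed_prod_update {G : Type*} [CommGroup G] {n : ℕ} (x : Fin n → G) (ε : Fin n → Bool)
    (k : Fin n) :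
    (∏ j, x j ^ (if Function.update ε k (!ε k) j then (1 : ℤ) else -1))
        * (x k ^ (if ε k then (1 : ℤ) else -1)) ^ 2
      = ∏ j, x j ^ (if ε j then (1 : ℤ) else -1) := by
  rw [← Finset.mul_prod_erase _ _ (Finset.mem_univ k),
    ← Finset.mul_prod_erase _ (fun j => x j ^ (if ε j then (1 : ℤ) else -1)) (Finset.mem_univ k)]
  have h : ∏ j ∈ Finset.univ.erase k,
        x j ^ (if Function.update ε k (!ε k) j then (1 : ℤ) else -1)
      = ∏ j ∈ Finset.univ.erase k, x j ^ (if ε j then (1 : ℤ) else -1) :=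
    Finset.prod_congr rfl fun j hj => by
      rw [Function.update_of_ne (Finset.ne_of_mem_erase hj)]
  rw [h, Function.update_self, mul_right_comm]
  congr 1
  cases ε k <;> simp [pow_two]

theorem prod_signed_prod_update {G : Type*} [CommGroup G] {m : ℕ} (x : Fin (m + 2) → G)
    (ε : Fin (m + 2) → Bool) :
    ∏ k, ∏ j, x j ^ (if Function.update ε k (!ε k) j then (1 : ℤ) else -1)
      = (∏ j, x j ^ (if ε j then (1 : ℤ) else -1)) ^ m := by
  have h := Finset.prod_congr (s₁ := Finset.univ) rfl fun k _ => signed_prod_update x ε k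
  rw [Finset.prod_mul_distrib, Finset.prod_pow, Finset.prod_const, Finset.card_univ,
    Fintype.card_fin, pow_add] at h
  exact mul_right_cancel h

theorem dist_one_signed_prod_le_sum_update {G : Type*} [CommGroup G] [MetricSpace G]
    (hinv : ∀ a b c : G, dist (a * c) (b * c) = dist a b)
    (hnormed : ∀ (z : G) (m : ℕ), dist (1 : G) (z ^ m) = m * dist (1 : G) z)
    {n : ℕ} (x : Fin n → G) (ε : Fin n → Bool) :
    ((n : ℝ) - 2) * dist (1 : G) (∏ j, x j ^ (if ε j then (1 : ℤ) else -1))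
      ≤ ∑ k, dist (1 : G)
          (∏ j, x j ^ (if Function.update ε k (!ε k) j then (1 : ℤ) else -1)) := by
  rcases lt_or_ge n 2 with hn | hn
  · have h : (n : ℝ) ≤ 2 := by exact_mod_cast hn.le
    exact (mul_nonpos_of_nonpos_of_nonneg (by linarith) dist_nonneg).trans
      (Finset.sum_nonneg fun _ _ => dist_nonneg)
  · obtain ⟨m, rfl⟩ := Nat.exists_eq_add_of_le' hn
    have h := dist_one_prod_le hinv Finset.univ
      (fun k => ∏ j, x j ^ (if Function.update ε k (!ε k) j then (1 : ℤ) else -1))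
    rw [prod_signed_prod_update, hnormed] at h
    push_cast
    linarith

/-- For an abelian normed metric group `G` and
`Pₙ(ε) = d(1, ∏ₖ xₖ^{εₖ})` with uniform signs: `E[Pₙ²] ≤ 2·(E[Pₙ])²`. -/
theorem second_moment_bound
    (G : Type*) [CommGroup G] [MetricSpace G]
    (hinv : ∀ a b c : G, dist (a * c) (b * c) = dist a b)
    (hnormed : ∀ (z : G) (m : ℕ), dist (1 : G) (z ^ m) = m * dist (1 : G) z)
    (n : ℕ) (x : Fin n → G) :
    (∑ ε : Fin n → Bool,
        dist (1 : G) (∏ k, x k ^ (if ε k then (1 : ℤ) else -1)) ^ 2) / 2 ^ n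
      ≤ 2 * ((∑ ε : Fin n → Bool,
          dist (1 : G) (∏ k, x k ^ (if ε k then (1 : ℤ) else -1))) / 2 ^ n) ^ 2 := by
  obtain ⟨f, hf⟩ : ∃ f : (Fin n → Bool) → ℝ,
      ∀ ε, dist (1 : G) (∏ k, x k ^ (if ε k then (1 : ℤ) else -1)) = f ε := ⟨_, fun _ => rfl⟩
  have hnonneg : ∀ ε, 0 ≤ f ε := fun ε => hf ε ▸ dist_nonneg
  have heven : ∀ ε, f (fun k => !ε k) = f ε := fun ε => by
    rw [← hf, ← hf, signed_prod_not]
    have h := hinv 1 (∏ k, x k ^ (if ε k then (1 : ℤ) else -1))⁻¹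
      (∏ k, x k ^ (if ε k then (1 : ℤ) else -1))
    rw [one_mul, inv_mul_cancel] at h
    rw [← h, dist_comm]
  have hlap : ∀ ε, ((n : ℝ) - 2) * f ε ≤ ∑ k, f (Function.update ε k (!ε k)) := fun ε => by
    simpa only [hf] using dist_one_signed_prod_le_sum_update hinv hnormed x ε
  have hadj : ((n : ℝ) - 2) * ∑ ε, f ε ^ 2 ≤ cubeAdjForm f := by
    rw [cubeAdjForm, Finset.mul_sum]
    refine Finset.sum_le_sum fun ε _ => ?_
    rw [← Finset.mul_sum]
    nlinarith [mul_le_mul_of_nonneg_left (hlap ε) (hnonneg ε)]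
  have hpoin := cube_poincare f
  simp only [heven, ← pow_two] at hpoin
  have hN : (0 : ℝ) < 2 ^ n := by positivity
  have hmul := mul_le_mul_of_nonneg_left hadj hN.le
  simp only [hf]
  rw [div_pow, ← mul_div_assoc, div_le_div_iff₀ hN (by positivity)]
  nlinarith
end

section
/- Let (G,·,d) be a metric semigroup, and for z ∈ G and m ∈ ℕ let z^m denote the m-fold product z·z⋯z. Suppose there exists an integer n ≥ 2 such that d(z, z^{n+1}) = n·d(z, z²) for all z ∈ G. Then d(z, z^{m+1}) = m·d(z, z²) for every m ∈ ℕ and every z ∈ G (i.e., G is ℕ-normed). -/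
/-- `sprod z m` is the `(m+1)`-fold product `z·z⋯z` in a semigroup, i.e. `z^(m+1)`. -/
def sprod {G : Type*} [Semigroup G] (z : G) : ℕ → G
  | 0 => z
  | m + 1 => sprod z m * z

theorem sprod_mul_sprod {G : Type*} [Semigroup G] (z : G) (a b : ℕ) :
    sprod z a * sprod z b = sprod z (a + (b + 1)) := by
  induction b with
  | zero => rfl
  | succ b ih =>
    change sprod z a * (sprod z b * z) = sprod z (a + (b + 1)) * z
    rw [← mul_assoc, ih]

theorem sprod_sprod {G : Type*} [Semigroup G] (z : G) (k m : ℕ) :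
    sprod (sprod z k) m = sprod z (k + (k + 1) * m) := by
  induction m with
  | zero => rfl
  | succ m ih =>
    change sprod (sprod z k) m * sprod z k = _
    rw [ih, sprod_mul_sprod]
    congr 1
    ring

theorem dist_sprod_sprod_add {G : Type*} [Semigroup G] [MetricSpace G]
    (hinv : ∀ a b c : G, dist (a * c) (b * c) = dist a b) (z : G) (a k : ℕ) :
    dist (sprod z a) (sprod z (a + k)) = dist z (sprod z k) := by
  induction a with
  | zero => rw [Nat.zero_add]; rfl
  | succ a ih =>
    rw [Nat.add_right_comm, ← ih]
    exact hinv _ _ _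

theorem dist_sprod_add_le {G : Type*} [Semigroup G] [MetricSpace G]
    (hinv : ∀ a b c : G, dist (a * c) (b * c) = dist a b) (z : G) (a b : ℕ) :
    dist z (sprod z (a + b)) ≤ dist z (sprod z a) + dist z (sprod z b) := by
  rw [← dist_sprod_sprod_add hinv z a b]
  exact dist_triangle _ _ _

theorem dist_sprod_le {G : Type*} [Semigroup G] [MetricSpace G]
    (hinv : ∀ a b c : G, dist (a * c) (b * c) = dist a b) (z : G) (m : ℕ) :
    dist z (sprod z m) ≤ m * dist z (sprod z 1) := by
  induction m with
  | zero => simp [sprod]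
  | succ m ih =>
    have := dist_sprod_add_le hinv z m 1
    push_cast
    linarith

theorem dist_sprod_succ_mul {G : Type*} [Semigroup G] [MetricSpace G]
    (hinv : ∀ a b c : G, dist (a * c) (b * c) = dist a b) {n : ℕ}
    (h : ∀ z : G, dist z (sprod z n) = n * dist z (sprod z 1)) (z : G) (k : ℕ) :
    dist z (sprod z ((k + 1) * n)) = n * dist z (sprod z (k + 1)) := by
  simpa only [sprod_sprod, dist_sprod_sprod_add hinv, mul_one] using h (sprod z k)

theorem dist_sprod_pow {G : Type*} [Semigroup G] [MetricSpace G]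
    (hinv : ∀ a b c : G, dist (a * c) (b * c) = dist a b) {n : ℕ} (hn : 0 < n)
    (h : ∀ z : G, dist z (sprod z n) = n * dist z (sprod z 1)) (z : G) (j : ℕ) :
    dist z (sprod z (n ^ j)) = (n : ℝ) ^ j * dist z (sprod z 1) := by
  induction j with
  | zero => simp
  | succ j ih =>
    obtain ⟨k, hk⟩ := Nat.exists_eq_succ_of_ne_zero (pow_pos hn j).ne'
    have hmul := dist_sprod_succ_mul hinv h z k
    rw [← Nat.succ_eq_add_one, ← hk, ← pow_succ, ih] at hmul
    rw [hmul]
    ring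


/-- If a metric semigroup satisfies `d(z, z^{n+1}) = n·d(z, z²)` for all `z`
for a single integer `n ≥ 2`, then it satisfies it for every `m ∈ ℕ` (it is ℕ-normed). -/
theorem normed_for_one_implies_normed_for_all
    (G : Type*) [Semigroup G] [MetricSpace G]
    (hinv : ∀ a b c : G, dist (a * c) (b * c) = dist a b ∧ dist (c * a) (c * b) = dist a b)
    (n : ℕ) (hn : 2 ≤ n) (h : ∀ z : G, dist z (sprod z n) = n * dist z (sprod z 1)) :
    ∀ (m : ℕ) (z : G), dist z (sprod z m) = m * dist z (sprod z 1) := by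
  intro m z
  have hr : ∀ a b c : G, dist (a * c) (b * c) = dist a b := fun a b c => (hinv a b c).1
  refine le_antisymm (dist_sprod_le hr z m) ?_
  have hm : m ≤ n ^ m := (Nat.lt_pow_self (by lia)).le
  have hpow := dist_sprod_pow hr (Nat.zero_lt_of_lt hn) h z m
  have hadd := dist_sprod_add_le hr z m (n ^ m - m)
  have hle := dist_sprod_le hr z (n ^ m - m)
  rw [Nat.add_sub_cancel' hm, hpow] at hadd
  rw [Nat.cast_sub hm, Nat.cast_pow, sub_mul] at hle
  linarith
end
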